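/- If a λ-graph bisystem (L⁻, L⁺) satisfies σ_{L⁻}-condition (I), then the topological dynamical system (X⁺_{L⁻}, σ_{L⁻}) is essentially free: for all m ≠ n in ℕ, the set {x ∈ X⁺_{L⁻} : σ_{L⁻}^m(x) = σ_{L⁻}^n(x)} has empty interior. -/

import Mathlib

/-- The underlying data of a λ-graph bisystem `(L⁻, L⁺)` over alphabets `Sm, Sp`:
common vertex sets `V l`, upward edges `Em l = E⁻_{l+1,l}` (source in `V (l+1)`,
terminal in `V l`) labeled in `Sm`, and downward edges `Ep l = E⁺_{l,l+1}`
(source in `V l`, terminal in `V (l+1)`) labeled in `Sp`. -/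
structure LGBSData (Sm Sp : Type) where
  V : ℕ → Type
  Em : ℕ → Type
  sm : ∀ l, Em l → V (l + 1)
  tm : ∀ l, Em l → V l
  lm : ∀ l, Em l → Sm
  Ep : ℕ → Type
  sp : ∀ l, Ep l → V l
  tp : ∀ l, Ep l → V (l + 1)
  lp : ∀ l, Ep l → Sp

/-- The axioms making the data `L` a λ-graph bisystem: finite nonempty vertex sets,
finitely many edges, every vertex has the required incoming and outgoing edges,
`λ⁻` is right-resolving, `λ⁺` is left-resolving, and the local property holds. -/
structure IsLGBS {Sm Sp : Type} (L : LGBSData Sm Sp) : Prop where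
  Vfin : ∀ l, Finite (L.V l)
  Vne : ∀ l, Nonempty (L.V l)
  Emfin : ∀ l, Finite (L.Em l)
  Epfin : ∀ l, Finite (L.Ep l)
  sm_surj : ∀ l, Function.Surjective (L.sm l)
  tm_surj : ∀ l, Function.Surjective (L.tm l)
  sp_surj : ∀ l, Function.Surjective (L.sp l)
  tp_surj : ∀ l, Function.Surjective (L.tp l)
  right_resolving : ∀ l (e f : L.Em l), L.sm l e = L.sm l f → L.lm l e = L.lm l f → e = f
  left_resolving : ∀ l (e f : L.Ep l), L.tp l e = L.tp l f → L.lp l e = L.lp l f → e = f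
  local_property : ∀ (l : ℕ) (u : L.V l) (v : L.V (l + 2)),
    ∃ φ : { p : L.Em l × L.Ep (l + 1) //
              L.tm l p.1 = u ∧ L.sm l p.1 = L.sp (l + 1) p.2 ∧ L.tp (l + 1) p.2 = v } ≃
          { q : L.Ep l × L.Em (l + 1) //
              L.sp l q.1 = u ∧ L.tp l q.1 = L.tm (l + 1) q.2 ∧ L.sm (l + 1) q.2 = v },
      ∀ p, L.lm l p.1.1 = L.lm (l + 1) (φ p).1.2 ∧ L.lp (l + 1) p.1.2 = L.lp l (φ p).1.1
/-- The follower set `F(u)` of a vertex `u ∈ V_l` in `L⁻`: label words of downward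
paths in `L⁻` from `u` to the top level `V_0`. -/
def follower {Sm Sp : Type} (L : LGBSData Sm Sp) : (l : ℕ) → L.V l → Set (List Sm)
  | 0, _ => {[]}
  | l + 1, u =>
      { w | ∃ e : L.Em l, L.sm l e = u ∧
            ∃ w', w' ∈ follower L l (L.tm l e) ∧ w = L.lm l e :: w' }

/-- The predecessor set `P(u)` of a vertex `u ∈ V_l` in `L⁺`: label words of paths
in `L⁺` from the top level `V_0` down to `u`. -/
def predecessor {Sm Sp : Type} (L : LGBSData Sm Sp) : (l : ℕ) → L.V l → Set (List Sp)
  | 0, _ => {[]}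
  | l + 1, u =>
      { w | ∃ e : L.Ep l, L.tp l e = u ∧
            ∃ w', w' ∈ predecessor L l (L.sp l e) ∧ w = w' ++ [L.lp l e] }

/-- FPCC (Follower-Predecessor Compatibility Condition) for a λ-graph bisystem over a
common alphabet: it is standard (`V 0` a singleton) and `F(u) = P(u)` for every vertex. -/
def LGBSData.FPCC {S : Type} (L : LGBSData S S) : Prop :=
  (Nonempty (L.V 0) ∧ Subsingleton (L.V 0)) ∧
  ∀ (l : ℕ) (u : L.V l), follower L l u = predecessor L l u
/-- Carrier of the space `Ω_{L⁻}` of left-infinite labeled paths of `L⁻`: the `l`-th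
entry records the vertex `u_{l+1} ∈ V_{l+1}` and the label `β_{-(l+1)}`. -/
abbrev OmegaC {Sm Sp : Type} (L : LGBSData Sm Sp) : Type := ∀ l : ℕ, L.V (l + 1) × Sm

/-- Membership in `Ω_{L⁻}`: the recorded vertices and labels come from a genuine
infinite labeled path in `L⁻`. -/
def OmegaM {Sm Sp : Type} (L : LGBSData Sm Sp) : Set (OmegaC L) :=
  { ω | (∃ e : L.Em 0, L.sm 0 e = (ω 0).1 ∧ L.lm 0 e = (ω 0).2) ∧
        ∀ l, ∃ e : L.Em (l + 1),
          L.sm (l + 1) e = (ω (l + 1)).1 ∧ L.lm (l + 1) e = (ω (l + 1)).2 ∧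
          L.tm (l + 1) e = (ω l).1 }

/-- The continuous graph `E⁺_{L⁻}`: `(ω, α, ω')` is an edge iff the labels of `ω'`
are those of `ω` shifted by one and at every level there is an `E⁺`-edge labeled `α`
from the vertex of `ω` to the corresponding vertex of `ω'` (including the level-`0`
edge from the bottom vertex `u_0` of `ω`). -/
def EplusRel {Sm Sp : Type} (L : LGBSData Sm Sp) (ω : OmegaC L) (α : Sp) (ω' : OmegaC L) :
    Prop :=
  (∀ l, (ω' (l + 1)).2 = (ω l).2) ∧
  (∀ l, ∃ e : L.Ep (l + 1),
      L.sp (l + 1) e = (ω l).1 ∧ L.tp (l + 1) e = (ω' (l + 1)).1 ∧ L.lp (l + 1) e = α) ∧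
  (∃ e0 : L.Ep 0, L.tp 0 e0 = (ω' 0).1 ∧ L.lp 0 e0 = α ∧
      ∃ em : L.Em 0, L.sm 0 em = (ω 0).1 ∧ L.lm 0 em = (ω 0).2 ∧ L.sp 0 e0 = L.tm 0 em)

/-- Carrier of the shift space `X⁺_{L⁻}`: the `i`-th entry records `(α_{i+1}, ω^{i+1})`. -/
abbrev XC {Sm Sp : Type} (L : LGBSData Sm Sp) : Type := ∀ i : ℕ, Sp × OmegaC L

/-- The shift space `X⁺_{L⁻}` inside `XC L`. -/
def XplusSet {Sm Sp : Type} (L : LGBSData Sm Sp) : Set (XC L) :=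
  { x | (∀ i, (x i).2 ∈ OmegaM L) ∧
        (∀ i, EplusRel L (x i).2 (x (i + 1)).1 (x (i + 1)).2) ∧
        ∃ ω0 ∈ OmegaM L, EplusRel L ω0 (x 0).1 (x 0).2 }

/-- The shift map `σ_{L⁻}` on `X⁺_{L⁻}`. -/
def shiftX {Sm Sp : Type} (L : LGBSData Sm Sp) (x : XC L) : XC L := fun i => x (i + 1)

/-- The cylinder set `U_{Ω_{L⁻}}(v ; ξ)` of paths passing through the vertex
`v ∈ V_l` whose last `l` labels form the word `ξ = (ξ_1, …, ξ_l)`. -/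
def cylOmega {Sm Sp : Type} (L : LGBSData Sm Sp) (l : ℕ) (v : L.V l) (ξ : List Sm) :
    Set (OmegaC L) :=
  { ω | (∀ (k : ℕ) (h : l = k + 1), (ω k).1 = h ▸ v) ∧
        ∀ j, j < l → ξ[j]? = some ((ω (l - j - 1)).2) }

/-- The cylinder set `U_{X⁺_{L⁻}}(v ; ξ) = {x | ω⁰(x) ∈ U_{Ω_{L⁻}}(v ; ξ)}`, where
`ω⁰(x)` is the (unique) element of `Ω_{L⁻}` with `(ω⁰(x), λ₁(x), ω¹(x)) ∈ E⁺_{L⁻}`. -/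
def cylX {Sm Sp : Type} (L : LGBSData Sm Sp) (l : ℕ) (v : L.V l) (ξ : List Sm) :
    Set (XC L) :=
  { x | ∃ ω0 ∈ OmegaM L, EplusRel L ω0 (x 0).1 (x 0).2 ∧ ω0 ∈ cylOmega L l v ξ }

/-- `A⁺_{l,l+1}(i, α, j) = 1`: there is an `E⁺`-edge labeled `α` from `v_i^l` to
`v_j^{l+1}`. -/
def ApOne {Sm Sp : Type} (L : LGBSData Sm Sp) (l : ℕ) (u : L.V l) (α : Sp)
    (v : L.V (l + 1)) : Prop :=
  ∃ e : L.Ep l, L.sp l e = u ∧ L.lp l e = α ∧ L.tp l e = v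

/-- The vertex sets of a λ-graph bisystem carry the discrete topology. -/
instance {Sm Sp : Type} (L : LGBSData Sm Sp) (l : ℕ) : TopologicalSpace (L.V l) := ⊥

/-- `σ_{L⁻}`-condition (I): for all `1 ≤ k ≤ l` one can choose a point
`x_i^l(ξ) ∈ U_{X⁺_{L⁻}}(v_i^l; ξ)` for every vertex `v_i^l ∈ V_l` and every
`ξ ∈ F(v_i^l)` such that `σ_{L⁻}^n (x_i^l(ξ)) ≠ x_j^l(η)` for all such chosen points
and all `n = 1, …, k`. -/
def ConditionI {Sm Sp : Type} (L : LGBSData Sm Sp) : Prop :=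
  ∀ l k : ℕ, 1 ≤ k → k ≤ l →
    ∃ x : ∀ (v : L.V l) (ξ : List Sm), ξ ∈ follower L l v → XC L,
      (∀ v ξ h, x v ξ h ∈ XplusSet L ∧ x v ξ h ∈ cylX L l v ξ) ∧
      ∀ v ξ h v' ξ' h' n, 1 ≤ n → n ≤ k → (shiftX L)^[n] (x v ξ h) ≠ x v' ξ' h'

/-- Two paths of `L⁻` with the same vertex at one level and the same labels up to that level
agree up to that level. -/
theorem OmegaM.eq_of_le {Sm Sp : Type} {L : LGBSData Sm Sp} (hL : IsLGBS L) {ω η : OmegaC L}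
    (hω : ω ∈ OmegaM L) (hη : η ∈ OmegaM L) {M : ℕ} (hv : (η M).1 = (ω M).1)
    (hl : ∀ k ≤ M, (η k).2 = (ω k).2) : ∀ k ≤ M, η k = ω k := by
  induction M with
  | zero =>
    intro k hk
    obtain rfl : k = 0 := by omega
    exact Prod.ext hv (hl 0 le_rfl)
  | succ M ih =>
    obtain ⟨e, he1, he2, he3⟩ := hω.2 M
    obtain ⟨f, hf1, hf2, hf3⟩ := hη.2 M
    have hfe : f = e := hL.right_resolving _ f e (by rw [hf1, he1, hv])
      (by rw [hf2, he2, hl _ le_rfl])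
    intro k hk
    rcases Nat.lt_or_ge M k with h | h
    · obtain rfl : k = M + 1 := by omega
      exact Prod.ext hv (hl _ le_rfl)
    · exact ih (by rw [← hf3, ← he3, hfe]) (fun k hk => hl k (by omega)) k h

/-- The word formed by the last `l` labels of a path. -/
def labelWord {Sm Sp : Type} {L : LGBSData Sm Sp} (ω : OmegaC L) : ℕ → List Sm
  | 0 => []
  | l + 1 => (ω l).2 :: labelWord ω l

theorem labelWord_getElem? {Sm Sp : Type} {L : LGBSData Sm Sp} (ω : OmegaC L) (l j : ℕ)
    (hj : j < l) : (labelWord ω l)[j]? = some (ω (l - j - 1)).2 := by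
  induction l generalizing j with
  | zero => omega
  | succ l ih =>
    cases j with
    | zero => simp [labelWord]
    | succ j =>
      rw [labelWord, List.getElem?_cons_succ, ih j (by omega), Nat.add_sub_add_right]

theorem labelWord_mem_follower {Sm Sp : Type} {L : LGBSData Sm Sp} {ω : OmegaC L}
    (hω : ω ∈ OmegaM L) (l : ℕ) : labelWord ω (l + 1) ∈ follower L (l + 1) (ω l).1 := by
  induction l with
  | zero =>
    obtain ⟨e, he1, he2⟩ := hω.1
    exact ⟨e, he1, [], rfl, by rw [he2]; rfl⟩
  | succ l ih =>
    obtain ⟨e, he1, he2, he3⟩ := hω.2 l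
    exact ⟨e, he1, labelWord ω (l + 1), by rw [he3]; exact ih, by rw [he2]; rfl⟩

theorem OmegaM.eq_of_mem_cylOmega {Sm Sp : Type} {L : LGBSData Sm Sp} (hL : IsLGBS L)
    {ω η : OmegaC L} (hω : ω ∈ OmegaM L) (hη : η ∈ OmegaM L) {M : ℕ}
    (h : η ∈ cylOmega L (M + 1) (ω M).1 (labelWord ω (M + 1))) : ∀ k ≤ M, η k = ω k := by
  refine OmegaM.eq_of_le hL hω hη (h.1 M rfl) fun k hk => ?_
  have hj := h.2 (M - k) (by omega)
  rw [labelWord_getElem? ω _ _ (by omega)] at hj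
  have hk' : M + 1 - (M - k) - 1 = k := by omega
  rw [hk'] at hj
  exact (Option.some.inj hj).symm

/-- An edge of `E⁺` entering the first vertex of a path of `L⁻` extends to an edge of the
continuous graph ending at that path. -/
theorem exists_EplusRel_of_edge {Sm Sp : Type} {L : LGBSData Sm Sp} (hL : IsLGBS L)
    {ζ' : OmegaC L} (hζ' : ζ' ∈ OmegaM L) (e₀ : L.Ep 0) (he₀ : L.tp 0 e₀ = (ζ' 0).1) :
    ∃ ζ ∈ OmegaM L, EplusRel L ζ (L.lp 0 e₀) ζ' := by
  have step : ∀ l (e : L.Ep l), L.tp l e = (ζ' l).1 →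
      ∃ (c : L.Em l) (e' : L.Ep (l + 1)), L.tm l c = L.sp l e ∧
        L.sm l c = L.sp (l + 1) e' ∧ L.lm l c = (ζ' (l + 1)).2 ∧
        L.tp (l + 1) e' = (ζ' (l + 1)).1 ∧ L.lp (l + 1) e' = L.lp l e := by
    intro l e he
    obtain ⟨f, hf1, hf2, hf3⟩ := hζ'.2 l
    obtain ⟨φ, hφ⟩ := hL.local_property l (L.sp l e) (ζ' (l + 1)).1
    have hp := hφ (φ.symm ⟨(e, f), rfl, he.trans hf3.symm, hf1⟩)
    rw [Equiv.apply_symm_apply] at hp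
    obtain ⟨h1, h2, h3⟩ := (φ.symm ⟨(e, f), rfl, he.trans hf3.symm, hf1⟩).2
    exact ⟨_, _, h1, h2, hp.1.trans hf2, h3, hp.2⟩
  have hex : ∀ l, ∃ e : L.Ep l, L.tp l e = (ζ' l).1 ∧ L.lp l e = L.lp 0 e₀ := by
    intro l
    induction l with
    | zero => exact ⟨e₀, he₀, rfl⟩
    | succ l ih =>
      obtain ⟨e, h1, h2⟩ := ih
      obtain ⟨-, e', -, -, -, h3, h4⟩ := step l e h1
      exact ⟨e', h3, h4.trans h2⟩
  choose g hg1 hg2 using hex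
  have conn : ∀ l, ∃ c : L.Em l, L.sm l c = L.sp (l + 1) (g (l + 1)) ∧
      L.lm l c = (ζ' (l + 1)).2 ∧ L.tm l c = L.sp l (g l) := by
    intro l
    obtain ⟨c, e', h1, h2, h3, h4, h5⟩ := step l (g l) (hg1 l)
    have he' : e' = g (l + 1) := hL.left_resolving _ _ _ (h4.trans (hg1 _).symm)
      (h5.trans ((hg2 l).trans (hg2 (l + 1)).symm))
    exact ⟨c, he' ▸ h2, h3, h1⟩
  refine ⟨fun l => (L.sp (l + 1) (g (l + 1)), (ζ' (l + 1)).2), ⟨?_, fun l => conn (l + 1)⟩,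
    fun l => rfl, fun l => ⟨g (l + 1), rfl, hg1 _, hg2 _⟩, ?_⟩
  · obtain ⟨c, h1, h2, -⟩ := conn 0
    exact ⟨c, h1, h2⟩
  · obtain ⟨c, h1, h2, h3⟩ := conn 0
    exact ⟨g 0, hg1 0, hg2 0, c, h1, h2, h3.symm⟩

theorem exists_EplusRel_of_agree {Sm Sp : Type} {L : LGBSData Sm Sp} (hL : IsLGBS L)
    {ω ω' ζ' : OmegaC L} {α : Sp} (hE : EplusRel L ω α ω') (hζ' : ζ' ∈ OmegaM L) {N : ℕ}
    (hag : ∀ k ≤ N + 1, ζ' k = ω' k) :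
    ∃ ζ ∈ OmegaM L, EplusRel L ζ α ζ' ∧ ∀ k ≤ N, ζ k = ω k := by
  obtain ⟨hE1, hE2, e₀, h1, rfl, -⟩ := hE
  obtain ⟨ζ, hζ, hζE⟩ := exists_EplusRel_of_edge hL hζ' e₀ (by rw [h1, hag 0 (by omega)])
  refine ⟨ζ, hζ, hζE, fun k hk => Prod.ext ?_ ?_⟩
  · obtain ⟨e, he1, he2, he3⟩ := hE2 k
    obtain ⟨f, hf1, hf2, hf3⟩ := hζE.2.1 k
    have hfe : f = e := hL.left_resolving _ _ _
      (by rw [hf2, he2, hag _ (by omega)]) (hf3.trans he3.symm)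
    rw [← he1, ← hf1, hfe]
  · rw [← hζE.1 k, ← hE1 k, hag _ (by omega)]

theorem shiftX_iterate_apply {Sm Sp : Type} (L : LGBSData Sm Sp) (x : XC L) (n i : ℕ) :
    (shiftX L)^[n] x i = x (i + n) := by
  induction n generalizing x with
  | zero => rfl
  | succ n ih =>
    rw [Function.iterate_succ_apply, ih]
    exact congrArg x (by omega)

/-- Prepend an entry to a sequence. -/
def consX {Sm Sp : Type} {L : LGBSData Sm Sp} (a : Sp × OmegaC L) (z : XC L) : XC L
  | 0 => a
  | i + 1 => z i

theorem consX_mem {Sm Sp : Type} {L : LGBSData Sm Sp} {ω η : OmegaC L} {α : Sp} {z : XC L}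
    (hz : z ∈ XplusSet L) (hη : η ∈ OmegaM L) (hηz : EplusRel L η (z 0).1 (z 0).2)
    (hω : ω ∈ OmegaM L) (hωη : EplusRel L ω α η) : consX (α, η) z ∈ XplusSet L := by
  refine ⟨fun i => ?_, fun i => ?_, ω, hω, hωη⟩
  · cases i with
    | zero => exact hη
    | succ i => exact hz.1 i
  · cases i with
    | zero => exact hηz
    | succ i => exact hz.2.1 i

/-- A point `z` whose initial path agrees with the path `ω^{K+1}` of `x` to sufficient depth has
a preimage under `σ^{K+1}` close to `x`. -/
theorem exists_preimage_of_agree {Sm Sp : Type} {L : LGBSData Sm Sp} (hL : IsLGBS L)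
    {x : XC L} (hx : x ∈ XplusSet L) (N K : ℕ) {z : XC L} {η : OmegaC L}
    (hz : z ∈ XplusSet L) (hη : η ∈ OmegaM L) (hηz : EplusRel L η (z 0).1 (z 0).2)
    (hag : ∀ k ≤ N + K + 1, η k = (x K).2 k) :
    ∃ y ∈ XplusSet L, (shiftX L)^[K + 1] y = z ∧
      ∀ i ≤ K, (y i).1 = (x i).1 ∧ ∀ k ≤ N, (y i).2 k = (x i).2 k := by
  induction K generalizing z η with
  | zero =>
    obtain ⟨ω, -, hωE⟩ := hx.2.2
    obtain ⟨ζ, hζ, hζE, -⟩ := exists_EplusRel_of_agree hL hωE hη hag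
    refine ⟨consX ((x 0).1, η) z, consX_mem hz hη hηz hζ hζE, rfl, fun i hi => ?_⟩
    obtain rfl : i = 0 := by omega
    exact ⟨rfl, fun k hk => hag k (by omega)⟩
  | succ K ih =>
    obtain ⟨ζ, hζ, hζE, hζag⟩ := exists_EplusRel_of_agree (N := N + K + 1) hL (hx.2.1 K) hη hag
    obtain ⟨y, hy, hyz, hyx⟩ := ih (z := consX ((x (K + 1)).1, η) z)
      (consX_mem hz hη hηz hζ hζE) hζ hζE hζag
    refine ⟨y, hy, by rw [Function.iterate_succ_apply', hyz]; rfl, fun i hi => ?_⟩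
    rcases Nat.lt_or_ge K i with h | h
    · obtain rfl : i = K + 1 := by omega
      have hyK : y (K + 1) = ((x (K + 1)).1, η) := by
        have := congrFun hyz 0
        rwa [shiftX_iterate_apply, Nat.zero_add] at this
      rw [hyK]
      exact ⟨rfl, fun k hk => hag k (by omega)⟩
    · exact hyx i h

theorem exists_not_eventually_periodic_near {Sm Sp : Type} {L : LGBSData Sm Sp} (hL : IsLGBS L)
    (hI : ConditionI L) {m n : ℕ} (hmn : m < n) {x : XC L} (hx : x ∈ XplusSet L) (N : ℕ) :
    ∃ y ∈ XplusSet L, (shiftX L)^[m] y ≠ (shiftX L)^[n] y ∧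
      ∀ i ≤ N, (y i).1 = (x i).1 ∧ ∀ k ≤ N, (y i).2 k = (x i).2 k := by
  obtain ⟨z, hz, hzne⟩ := hI (N + (N + n) + 1 + 1) (n - m) (by omega) (by omega)
  have hω := hx.1 (N + n)
  have hF := labelWord_mem_follower hω (N + (N + n) + 1)
  obtain ⟨hzX, η, hη, hηz, hcyl⟩ := hz _ _ hF
  obtain ⟨y, hy, hyz, hyx⟩ := exists_preimage_of_agree hL hx N (N + n) hzX hη hηz
    (OmegaM.eq_of_mem_cylOmega hL hω hη hcyl)
  refine ⟨y, hy, fun heq => hzne _ _ hF _ _ hF (n - m) (by omega) le_rfl ?_,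
    fun i hi => hyx i (by omega)⟩
  rw [← hyz, ← Function.iterate_add_apply]
  have h := congrArg (shiftX L)^[N + n + 1 - m] heq
  rw [← Function.iterate_add_apply, ← Function.iterate_add_apply] at h
  rw [show n - m + (N + n + 1) = N + n + 1 - m + n by omega, ← h,
    show N + n + 1 - m + m = N + n + 1 by omega]

theorem interior_eventually_periodic_eq_empty {Sm Sp : Type} [TopologicalSpace Sm]
    [TopologicalSpace Sp] {L : LGBSData Sm Sp} (hL : IsLGBS L) (hI : ConditionI L) {m n : ℕ}
    (hmn : m < n) :
    interior {x : ↥(XplusSet L) | (shiftX L)^[m] x.1 = (shiftX L)^[n] x.1} = ∅ := by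
  refine Set.eq_empty_iff_forall_notMem.2 fun x hx => ?_
  choose y hy hyne hyx using exists_not_eventually_periodic_near hL hI hmn x.2
  have hlim : Filter.Tendsto (fun N => (⟨y N, hy N⟩ : ↥(XplusSet L))) Filter.atTop (nhds x) := by
    refine tendsto_subtype_rng.2 (tendsto_pi_nhds.2 fun i => Filter.Tendsto.prodMk_nhds ?_
      (tendsto_pi_nhds.2 fun k => ?_))
    · refine tendsto_const_nhds.congr' ?_
      filter_upwards [Filter.eventually_ge_atTop i] with N hN
      exact (hyx N i hN).1.symm
    · refine tendsto_const_nhds.congr' ?_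
      filter_upwards [Filter.eventually_ge_atTop i, Filter.eventually_ge_atTop k] with N hN hk
      exact ((hyx N i hN).2 k hk).symm
  obtain ⟨N, hN⟩ := (hlim.eventually (mem_interior_iff_mem_nhds.1 hx)).exists
  exact hyne N hN

/-- if a λ-graph bisystem satisfies `σ_{L⁻}`-condition (I), then the
topological dynamical system `(X⁺_{L⁻}, σ_{L⁻})` is essentially free: for all
`m ≠ n`, the set `{x ∈ X⁺_{L⁻} | σ_{L⁻}^m x = σ_{L⁻}^n x}` has empty interior
(in the space `X⁺_{L⁻}` with its natural product topology, the alphabets and vertex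
sets being discrete). -/
theorem stmt_19 {Sm Sp : Type} [Finite Sm] [Finite Sp]
    [TopologicalSpace Sm] [DiscreteTopology Sm] [TopologicalSpace Sp] [DiscreteTopology Sp]
    (L : LGBSData Sm Sp) (hL : IsLGBS L) (hI : ConditionI L)
    (m n : ℕ) (hmn : m ≠ n) :
    interior {x : ↥(XplusSet L) | (shiftX L)^[m] x.1 = (shiftX L)^[n] x.1} = ∅ := by
  rcases Nat.lt_or_gt_of_ne hmn with h | h
  · exact interior_eventually_periodic_eq_empty hL hI h
  · simp only [eq_comm (a := (shiftX L)^[m] _)]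
    exact interior_eventually_periodic_eq_empty hL hI h
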